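/- arXiv:2203.16668 — 8 statements merged into one kernel-verified Lean document; each statement's English description precedes it below -/
import Mathlib

section
/- Let R_p(g) := E[(r(a) − μ̂(x) − ⟨e_a − p(x), g(x,·)⟩)²]. Then for every bounded measurable g : X×A → ℝ, R_p(g) = E[(r(a) − f*(x,a))²] + E_{x∼ν}[Σ_{a∈A} p(a|x) ⟨e_a − p(x), f*(x,·) − g(x,·)⟩²] + E_{x∼ν}[(μ(x) − μ̂(x))²], where μ(x) := Σ_{a∈A} p(a|x) f*(x,a). -/
open MeasureTheory

/-- The R-loss risk `R_p(g) = E[(r(a) − μ̂(x) − ⟨e_a − p(x), g(x,·)⟩)²]`,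
where the data `(x, a, r)` is given by random variables `ξ, α, ρ` on `(Ω, P)`. -/
noncomputable def Rloss {X A Ω : Type*} [Fintype A] [MeasurableSpace Ω]
    (P : Measure Ω) (p : X → A → ℝ)
    (ξ : Ω → X) (α : Ω → A) (ρ : Ω → A → ℝ) (μhat : X → ℝ) (g : X → A → ℝ) : ℝ :=
  ∫ ω, (ρ ω (α ω) - μhat (ξ ω) -
      (g (ξ ω) (α ω) - ∑ a', p (ξ ω) a' * g (ξ ω) a')) ^ 2 ∂P

theorem rloss_decomposition
    {X : Type*} [MeasurableSpace X] (ν : Measure X) [IsProbabilityMeasure ν]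
    {A : Type*} [Fintype A] [Nonempty A]
    [MeasurableSpace A] [MeasurableSingletonClass A]
    -- the probability kernel `p`
    (p : X → A → ℝ)
    (hp0 : ∀ x a, 0 ≤ p x a) (hp1 : ∀ x, ∑ a, p x a = 1)
    (hpm : ∀ a, Measurable fun x => p x a)
    -- the random triple `(x, a, r)` on a probability space `(Ω, P)`
    {Ω : Type*} [MeasurableSpace Ω] (P : Measure Ω) [IsProbabilityMeasure P]
    (ξ : Ω → X) (α : Ω → A) (ρ : Ω → A → ℝ)
    (hξ : Measurable ξ) (hα : Measurable α) (hρm : ∀ a, Measurable fun ω => ρ ω a)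
    (hρ : ∀ ω a, ρ ω a ∈ Set.Icc (0 : ℝ) 1)
    -- `f*(x,a) = E[r(a) | x]`
    (fstar : X → A → ℝ)
    (hfm : ∀ a, Measurable fun x => fstar x a)
    (hfb : ∀ x a, fstar x a ∈ Set.Icc (0 : ℝ) 1)
    (hortho : ∀ ψ : X → A → ℝ, (∀ a, Measurable fun x => ψ x a) →
      (∃ C, ∀ x a, |ψ x a| ≤ C) →
      ∫ ω, (ρ ω (α ω) - fstar (ξ ω) (α ω)) * ψ (ξ ω) (α ω) ∂P = 0)
    -- `x` has law `ν` and, conditionally on `x`, `a ∼ p(·|x)`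
    (hlaw : ∀ φ : X → A → ℝ, (∀ a, Measurable fun x => φ x a) →
      (∃ C, ∀ x a, |φ x a| ≤ C) →
      ∫ ω, φ (ξ ω) (α ω) ∂P = ∫ x, ∑ a, p x a * φ x a ∂ν)
    -- the fixed nuisance estimate `μ̂`
    (μhat : X → ℝ) (hμm : Measurable μhat) (hμb : ∃ C, ∀ x, |μhat x| ≤ C) :
    ∀ g : X → A → ℝ, (∀ a, Measurable fun x => g x a) → (∃ C, ∀ x a, |g x a| ≤ C) →
      Rloss P p ξ α ρ μhat g
        = (∫ ω, (ρ ω (α ω) - fstar (ξ ω) (α ω)) ^ 2 ∂P)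
          + (∫ x, ∑ a, p x a *
              ((fstar x a - g x a) - ∑ a', p x a' * (fstar x a' - g x a')) ^ 2 ∂ν)
          + ∫ x, ((∑ a, p x a * fstar x a) - μhat x) ^ 2 ∂ν := by
  intro g hgm ⟨G, hG⟩
  obtain ⟨M, hM⟩ := hμb
  have key : ∀ F : Ω → A → ℝ, (∀ a, Measurable fun ω => F ω a) →
      Measurable fun ω => F ω (α ω) := by
    intro F hF
    have : Measurable (fun q : Ω × A => F q.1 q.2) :=
      measurable_from_prod_countable_left (fun a => hF a)
    exact this.comp (measurable_id.prodMk hα)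
  have avg : ∀ (u : X → A → ℝ) (C : ℝ), (∀ x a, |u x a| ≤ C) → ∀ x, |∑ a, p x a * u x a| ≤ C := by
    intro u C hu x
    calc |∑ a, p x a * u x a| ≤ ∑ a, |p x a * u x a| := Finset.abs_sum_le_sum_abs _ _
      _ ≤ ∑ a, p x a * C := Finset.sum_le_sum fun a _ => by
          rw [abs_mul, abs_of_nonneg (hp0 x a)]
          exact mul_le_mul_of_nonneg_left (hu x a) (hp0 x a)
      _ = C := by rw [← Finset.sum_mul, hp1, one_mul]
  have avgm : ∀ (u : X → A → ℝ), (∀ a, Measurable fun x => u x a) →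
      Measurable fun x => ∑ a, p x a * u x a := fun u hu =>
    Finset.measurable_sum _ fun a _ => (hpm a).mul (hu a)
  have hf1 : ∀ x a, |fstar x a| ≤ 1 := fun x a =>
    abs_le.2 ⟨by linarith [(hfb x a).1], (hfb x a).2⟩
  set D : X → A → ℝ := fun x a =>
    (fstar x a - g x a) - ∑ a', p x a' * (fstar x a' - g x a') with hD
  set m : X → ℝ := fun x => (∑ a, p x a * fstar x a) - μhat x with hm
  have hfg : ∀ x a, |fstar x a - g x a| ≤ 1 + G := fun x a =>
    (abs_sub _ _).trans (add_le_add (hf1 x a) (hG x a))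
  have hDb : ∀ x a, |D x a| ≤ (1 + G) + (1 + G) := fun x a =>
    (abs_sub _ _).trans (add_le_add (hfg x a) (avg (fun x a => fstar x a - g x a) _ hfg x))
  have hmb : ∀ x, |m x| ≤ 1 + M := fun x =>
    (abs_sub _ _).trans (add_le_add (avg _ _ hf1 x) (hM x))
  have hDm : ∀ a, Measurable fun x => D x a := fun a =>
    ((hfm a).sub (hgm a)).sub (avgm (fun x a => fstar x a - g x a) fun a => (hfm a).sub (hgm a))
  have hmm : Measurable m := (avgm _ hfm).sub hμm
  set h : X → A → ℝ := fun x a => D x a + m x with hh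
  have hhm : ∀ a, Measurable fun x => h x a := fun a => (hDm a).add hmm
  obtain ⟨C, hC⟩ : ∃ C, ∀ x a, |h x a| ≤ C :=
    ⟨_, fun x a => (abs_add_le _ _).trans (add_le_add (hDb x a) (hmb x))⟩
  have hsq : ∀ y B : ℝ, |y| ≤ B → |y ^ 2| ≤ B ^ 2 := fun y B hy => by
    rw [abs_pow]; exact pow_le_pow_left₀ (abs_nonneg _) hy 2
  -- the noise
  set ε : Ω → ℝ := fun ω => ρ ω (α ω) - fstar (ξ ω) (α ω) with hε
  have hεm : Measurable ε := (key ρ hρm).sub (key (fun ω a => fstar (ξ ω) a) fun a => (hfm a).comp hξ)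
  have hεb : ∀ ω, |ε ω| ≤ 1 := fun ω => by
    have h1 := hρ ω (α ω); have h2 := hfb (ξ ω) (α ω)
    exact abs_le.2 ⟨by simp only [hε]; linarith [h1.1, h2.2], by simp only [hε]; linarith [h1.2, h2.1]⟩
  have hHm : Measurable fun ω => h (ξ ω) (α ω) :=
    key (fun ω a => h (ξ ω) a) fun a => (hhm a).comp hξ
  have i1 : Integrable (fun ω => ε ω ^ 2) P :=
    Integrable.of_bound (hεm.pow_const 2).aestronglyMeasurable (1 ^ 2)
      (Filter.Eventually.of_forall fun ω => hsq _ _ (hεb ω))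
  have i2 : Integrable (fun ω => ε ω * (2 * h (ξ ω) (α ω))) P :=
    Integrable.of_bound (hεm.mul (hHm.const_mul 2)).aestronglyMeasurable (1 * (2 * C))
      (Filter.Eventually.of_forall fun ω => by
        rw [Real.norm_eq_abs, abs_mul, abs_mul, abs_two]
        have := hC (ξ ω) (α ω)
        exact mul_le_mul (hεb ω) (by linarith) (by positivity) zero_le_one)
  have i3 : Integrable (fun ω => h (ξ ω) (α ω) ^ 2) P :=
    Integrable.of_bound (hHm.pow_const 2).aestronglyMeasurable (C ^ 2)
      (Filter.Eventually.of_forall fun ω => hsq _ _ (hC _ _))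
  have j1 : Integrable (fun x => ∑ a, p x a * D x a ^ 2) ν :=
    Integrable.of_bound (avgm (fun x a => D x a ^ 2) fun a => (hDm a).pow_const 2).aestronglyMeasurable
      (((1 + G) + (1 + G)) ^ 2)
      (Filter.Eventually.of_forall fun x =>
        avg (fun x a => D x a ^ 2) _ (fun x a => hsq _ _ (hDb x a)) x)
  have j2 : Integrable (fun x => m x ^ 2) ν :=
    Integrable.of_bound (hmm.pow_const 2).aestronglyMeasurable ((1 + M) ^ 2)
      (Filter.Eventually.of_forall fun x => hsq _ _ (hmb x))
  have o := hortho (fun x a => 2 * h x a) (fun a => (hhm a).const_mul 2)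
    ⟨2 * C, fun x a => by rw [abs_mul, abs_two]; linarith [hC x a]⟩
  have l := hlaw (fun x a => h x a ^ 2) (fun a => (hhm a).pow_const 2)
    ⟨C ^ 2, fun x a => hsq _ _ (hC x a)⟩
  have hD0 : ∀ x, ∑ a, p x a * D x a = 0 := fun x => by
    simp only [hD, mul_sub (p x _) (fstar x _ - g x _), Finset.sum_sub_distrib,
      ← Finset.sum_mul, hp1, one_mul, sub_self]
  have pt : ∀ x, ∑ a, p x a * h x a ^ 2 = (∑ a, p x a * D x a ^ 2) + m x ^ 2 := fun x => by
    have : ∀ a, p x a * h x a ^ 2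
        = p x a * D x a ^ 2 + (p x a * D x a) * (2 * m x) + p x a * m x ^ 2 := fun a => by
      simp only [hh]; ring
    simp only [this, Finset.sum_add_distrib, ← Finset.sum_mul, hD0, hp1]
    ring
  have hint : ∀ ω, (ρ ω (α ω) - μhat (ξ ω) -
      (g (ξ ω) (α ω) - ∑ a', p (ξ ω) a' * g (ξ ω) a')) ^ 2
      = ε ω ^ 2 + ε ω * (2 * h (ξ ω) (α ω)) + h (ξ ω) (α ω) ^ 2 := fun ω => by
    simp only [hε, hh, hD, hm, mul_sub, Finset.sum_sub_distrib]
    ring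
  unfold Rloss
  simp only [hint]
  have i12 : Integrable (fun ω => ε ω ^ 2 + ε ω * (2 * h (ξ ω) (α ω))) P := i1.add i2
  have o2 : ∫ ω, ε ω * (2 * h (ξ ω) (α ω)) ∂P = 0 := o
  rw [integral_add i12 i3, integral_add i1 i2, o2, l]
  simp only [pt]
  rw [integral_add j1 j2, add_zero, ← add_assoc]
end

section
/- For a fixed kernel p, the R-loss risk differences do not depend on the nuisance estimate μ̂: if R_p^{μ̂}(g) := E[(r(a) − μ̂(x) − ⟨e_a − p(x), g(x,·)⟩)²], then for any two bounded measurable functions μ̂₁, μ̂₂ : X → ℝ and any bounded measurable g, g' : X×A → ℝ, R_p^{μ̂₁}(g) − R_p^{μ̂₁}(g') = R_p^{μ̂₂}(g) − R_p^{μ̂₂}(g'). -/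
open MeasureTheory

theorem aux_meas {A Ω : Type*} [Fintype A] [MeasurableSpace A] [MeasurableSingletonClass A]
    [MeasurableSpace Ω] (α : Ω → A) (hα : Measurable α) (h : Ω → A → ℝ)
    (hh : ∀ a, Measurable fun ω => h ω a) : Measurable fun ω => h ω (α ω) := by
  classical
  have e : (fun ω => h ω (α ω)) = fun ω => ∑ a, if α ω = a then h ω a else 0 := by
    funext ω
    simp
  rw [e]
  refine Finset.measurable_sum _ fun a _ => ?_
  exact Measurable.ite (hα (measurableSet_singleton a)) (hh a) measurable_const

theorem aux_sum {A : Type*} [Fintype A] (p g : A → ℝ) (h0 : ∀ a, 0 ≤ p a) (h1 : ∑ a, p a = 1)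
    (C : ℝ) (hg : ∀ a, |g a| ≤ C) : |∑ a, p a * g a| ≤ C := by
  calc |∑ a, p a * g a| ≤ ∑ a, |p a * g a| := Finset.abs_sum_le_sum_abs _ _
    _ ≤ ∑ a, p a * C := by
        refine Finset.sum_le_sum fun a _ => ?_
        rw [abs_mul, abs_of_nonneg (h0 a)]
        exact mul_le_mul_of_nonneg_left (hg a) (h0 a)
    _ = C := by rw [← Finset.sum_mul, h1, one_mul]

theorem rloss_difference_independent_of_nuisance
{X : Type*} [MeasurableSpace X] (ν : Measure X) [IsProbabilityMeasure ν]
    {A : Type*} [Fintype A] [Nonempty A]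
    [MeasurableSpace A] [MeasurableSingletonClass A]
    -- the probability kernel `p`
    (p : X → A → ℝ)
    (hp0 : ∀ x a, 0 ≤ p x a) (hp1 : ∀ x, ∑ a, p x a = 1)
    (hpm : ∀ a, Measurable fun x => p x a)
    -- the random triple `(x, a, r)` on a probability space `(Ω, P)`
    {Ω : Type*} [MeasurableSpace Ω] (P : Measure Ω) [IsProbabilityMeasure P]
    (ξ : Ω → X) (α : Ω → A) (ρ : Ω → A → ℝ)
    (hξ : Measurable ξ) (hα : Measurable α) (hρm : ∀ a, Measurable fun ω => ρ ω a)
    (hρ : ∀ ω a, ρ ω a ∈ Set.Icc (0 : ℝ) 1)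
    -- `f*(x,a) = E[r(a) | x]`
    (fstar : X → A → ℝ)
    (hfm : ∀ a, Measurable fun x => fstar x a)
    (hfb : ∀ x a, fstar x a ∈ Set.Icc (0 : ℝ) 1)
    (hortho : ∀ ψ : X → A → ℝ, (∀ a, Measurable fun x => ψ x a) →
      (∃ C, ∀ x a, |ψ x a| ≤ C) →
      ∫ ω, (ρ ω (α ω) - fstar (ξ ω) (α ω)) * ψ (ξ ω) (α ω) ∂P = 0)
    -- `x` has law `ν` and, conditionally on `x`, `a ∼ p(·|x)`
    (hlaw : ∀ φ : X → A → ℝ, (∀ a, Measurable fun x => φ x a) →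
      (∃ C, ∀ x a, |φ x a| ≤ C) →
      ∫ ω, φ (ξ ω) (α ω) ∂P = ∫ x, ∑ a, p x a * φ x a ∂ν) :
    ∀ μ1 μ2 : X → ℝ, Measurable μ1 → Measurable μ2 →
      (∃ C, ∀ x, |μ1 x| ≤ C) → (∃ C, ∀ x, |μ2 x| ≤ C) →
      ∀ g g' : X → A → ℝ,
        (∀ a, Measurable fun x => g x a) → (∃ C, ∀ x a, |g x a| ≤ C) →
        (∀ a, Measurable fun x => g' x a) → (∃ C, ∀ x a, |g' x a| ≤ C) →
        Rloss P p ξ α ρ μ1 g - Rloss P p ξ α ρ μ1 g'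
          = Rloss P p ξ α ρ μ2 g - Rloss P p ξ α ρ μ2 g' := by
  intro μ1 μ2 hμ1 hμ2 hb1 hb2
  obtain ⟨C1, hC1⟩ := hb1
  obtain ⟨C2, hC2⟩ := hb2
  have hrm : Measurable fun ω => ρ ω (α ω) := aux_meas α hα ρ hρm
  have hrb : ∀ ω, |ρ ω (α ω)| ≤ 1 := fun ω => by
    rw [abs_of_nonneg (hρ ω _).1]; exact (hρ ω _).2
  have key : ∀ g : X → A → ℝ, (∀ a, Measurable fun x => g x a) → (∃ C, ∀ x a, |g x a| ≤ C) →
      Rloss P p ξ α ρ μ1 g - Rloss P p ξ α ρ μ2 g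
        = ∫ ω, (μ2 (ξ ω) - μ1 (ξ ω)) * (2 * ρ ω (α ω) - μ1 (ξ ω) - μ2 (ξ ω)) ∂P := by
    rintro g hg ⟨C, hC⟩
    have hsm : Measurable fun x => ∑ a', p x a' * g x a' :=
      Finset.measurable_sum _ fun a _ => (hpm a).mul (hg a)
    have hsb : ∀ x, |∑ a', p x a' * g x a'| ≤ C := fun x =>
      aux_sum (p x) (g x) (hp0 x) (hp1 x) C (hC x)
    have hgm : Measurable fun ω => g (ξ ω) (α ω) :=
      aux_meas α hα (fun ω a => g (ξ ω) a) fun a => (hg a).comp hξ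
    have hDm : Measurable fun ω => g (ξ ω) (α ω) - ∑ a', p (ξ ω) a' * g (ξ ω) a' :=
      hgm.sub (hsm.comp hξ)
    have hDb : ∀ x a, |g x a - ∑ a', p x a' * g x a'| ≤ C + C := fun x a =>
      (abs_sub _ _).trans (add_le_add (hC x a) (hsb x))
    have hint : ∀ (μ : X → ℝ) (B : ℝ), Measurable μ → (∀ x, |μ x| ≤ B) →
        Integrable (fun ω => (ρ ω (α ω) - μ (ξ ω) -
          (g (ξ ω) (α ω) - ∑ a', p (ξ ω) a' * g (ξ ω) a')) ^ 2) P := by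
      intro μ B hμ hB
      refine Integrable.of_bound
        (((hrm.sub (hμ.comp hξ)).sub hDm).pow_const 2).aestronglyMeasurable
        ((1 + B + (C + C)) ^ 2) (Filter.Eventually.of_forall fun ω => ?_)
      rw [Real.norm_eq_abs, abs_pow]
      refine pow_le_pow_left₀ (abs_nonneg _) ?_ 2
      exact (abs_sub _ _).trans (add_le_add
        ((abs_sub _ _).trans (add_le_add (hrb ω) (hB _))) (hDb _ _))
    have hz : ∫ ω, (μ2 (ξ ω) - μ1 (ξ ω)) *
        (g (ξ ω) (α ω) - ∑ a', p (ξ ω) a' * g (ξ ω) a') ∂P = 0 := by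
      rw [hlaw (fun x a => (μ2 x - μ1 x) * (g x a - ∑ a', p x a' * g x a'))
        (fun a => (hμ2.sub hμ1).mul ((hg a).sub hsm))
        ⟨(C2 + C1) * (C + C), fun x a => by
          rw [abs_mul]
          have h1 := (abs_sub (μ2 x) (μ1 x)).trans (add_le_add (hC2 x) (hC1 x))
          exact mul_le_mul h1 (hDb x a) (abs_nonneg _) ((abs_nonneg _).trans h1)⟩]
      have : ∀ x, ∑ a, p x a * ((μ2 x - μ1 x) * (g x a - ∑ a', p x a' * g x a')) = 0 := by
        intro x
        have e : ∀ a, p x a * ((μ2 x - μ1 x) * (g x a - ∑ a', p x a' * g x a'))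
            = (μ2 x - μ1 x) * (p x a * g x a - p x a * ∑ a', p x a' * g x a') := by
          intro a; ring
        simp only [e]
        rw [← Finset.mul_sum, Finset.sum_sub_distrib, ← Finset.sum_mul, hp1]
        ring
      simp [this]
    have hDi : Integrable (fun ω => (μ2 (ξ ω) - μ1 (ξ ω)) *
        (g (ξ ω) (α ω) - ∑ a', p (ξ ω) a' * g (ξ ω) a')) P := by
      refine Integrable.of_bound
        (((hμ2.comp hξ).sub (hμ1.comp hξ)).mul hDm).aestronglyMeasurable
        ((C2 + C1) * (C + C)) (Filter.Eventually.of_forall fun ω => ?_)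
      rw [Real.norm_eq_abs, abs_mul]
      have h1 := (abs_sub (μ2 (ξ ω)) (μ1 (ξ ω))).trans (add_le_add (hC2 _) (hC1 _))
      exact mul_le_mul h1 (hDb _ _) (abs_nonneg _) ((abs_nonneg _).trans h1)
    unfold Rloss
    have h12 := (hint μ1 C1 hμ1 hC1).sub (hint μ2 C2 hμ2 hC2)
    rw [← integral_sub (hint μ1 C1 hμ1 hC1) (hint μ2 C2 hμ2 hC2)]
    have h3 := integral_add h12 (hDi.const_mul 2)
    rw [integral_const_mul, hz, mul_zero, add_zero] at h3
    refine h3.symm.trans (integral_congr_ae (Filter.Eventually.of_forall fun ω => ?_))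
    simp only [Pi.sub_apply]
    ring
  intro g g' hg hgb hg' hgb'
  have k1 := key g hg hgb
  have k2 := key g' hg' hgb'
  linarith
end

section
/- In the two-action case A = {0, 1}, write e(x) := p(1|x) and, for bounded measurable g : X×A → ℝ, write τ_g(x) := g(x,1) − g(x,0) and τ*(x) := f*(x,1) − f*(x,0). Let R_p(g) := E[(r(a) − μ̂(x) − ⟨e_a − p(x), g(x,·)⟩)²]. Then the excess risk of g satisfies R_p(g) − R_p(f*) = E_{x∼ν}[e(x)(1 − e(x))(τ_g(x) − τ*(x))²]. -/
open MeasureTheory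

def BM {Y : Type*} [MeasurableSpace Y] (F : Y → ℝ) : Prop :=
  Measurable F ∧ ∃ C, ∀ y, |F y| ≤ C

theorem BM.add {Y : Type*} [MeasurableSpace Y] {F G : Y → ℝ} (hF : BM F) (hG : BM G) :
    BM (fun y => F y + G y) := by
  obtain ⟨h1, C, hC⟩ := hF
  obtain ⟨h2, D, hD⟩ := hG
  exact ⟨h1.add h2, C + D, fun y => (abs_add_le _ _).trans (add_le_add (hC y) (hD y))⟩

theorem BM.sub {Y : Type*} [MeasurableSpace Y] {F G : Y → ℝ} (hF : BM F) (hG : BM G) :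
    BM (fun y => F y - G y) := by
  obtain ⟨h1, C, hC⟩ := hF
  obtain ⟨h2, D, hD⟩ := hG
  exact ⟨h1.sub h2, C + D, fun y => (abs_sub _ _).trans (add_le_add (hC y) (hD y))⟩

theorem BM.mul {Y : Type*} [MeasurableSpace Y] {F G : Y → ℝ} (hF : BM F) (hG : BM G) :
    BM (fun y => F y * G y) := by
  obtain ⟨h1, C, hC⟩ := hF
  obtain ⟨h2, D, hD⟩ := hG
  refine ⟨h1.mul h2, C * D, fun y => ?_⟩
  rw [abs_mul]
  exact mul_le_mul (hC y) (hD y) (abs_nonneg _) ((abs_nonneg _).trans (hC y))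

theorem BM.const {Y : Type*} [MeasurableSpace Y] (c : ℝ) : BM (fun _ : Y => c) :=
  ⟨measurable_const, |c|, fun _ => le_rfl⟩

theorem BM.comp {Y Z : Type*} [MeasurableSpace Y] [MeasurableSpace Z] {F : Y → ℝ} (hF : BM F)
    {k : Z → Y} (hk : Measurable k) : BM (fun z => F (k z)) :=
  ⟨hF.1.comp hk, hF.2.imp fun _ h z => h _⟩

theorem BM.bdd {Y : Type*} [MeasurableSpace Y] {F : Y → Fin 2 → ℝ}
    (hF : ∀ a, BM (fun y => F y a)) : ∃ C, ∀ y a, |F y a| ≤ C := by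
  obtain ⟨C, hC⟩ := (hF 0).2
  obtain ⟨D, hD⟩ := (hF 1).2
  refine ⟨max C D, fun y a => ?_⟩
  fin_cases a
  · exact (hC y).trans (le_max_left _ _)
  · exact (hD y).trans (le_max_right _ _)

theorem BM.pick {Y : Type*} [MeasurableSpace Y] {F : Y → Fin 2 → ℝ}
    (hF : ∀ a, BM (fun y => F y a)) {α : Y → Fin 2} (hα : Measurable α) :
    BM (fun y => F y (α y)) := by
  obtain ⟨C, hC⟩ := BM.bdd hF
  refine ⟨?_, C, fun y => hC y _⟩
  have h : (fun y => F y (α y)) = fun y => if α y = 0 then F y 0 else F y 1 := by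
    funext y
    split_ifs with h
    · rw [h]
    · rw [show α y = 1 by omega]
  rw [h]
  exact Measurable.ite (hα (measurableSet_singleton 0)) (hF 0).1 (hF 1).1

theorem BM.int {Y : Type*} [MeasurableSpace Y] {F : Y → ℝ} (hF : BM F)
    (P : Measure Y) [IsProbabilityMeasure P] : Integrable F P := by
  obtain ⟨h, C, hC⟩ := hF
  exact Integrable.of_bound h.aestronglyMeasurable C (Filter.Eventually.of_forall hC)

/-- Two-action case `A = {0, 1}` with `e(x) = p(1|x)`,
`τ_g(x) = g(x,1) − g(x,0)`, `τ*(x) = f*(x,1) − f*(x,0)`. -/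
theorem rloss_excess_risk_two_arms
    {X : Type*} [MeasurableSpace X] (ν : Measure X) [IsProbabilityMeasure ν]
    -- the probability kernel `p`
    (p : X → Fin 2 → ℝ)
    (hp0 : ∀ x a, 0 ≤ p x a) (hp1 : ∀ x, ∑ a, p x a = 1)
    (hpm : ∀ a, Measurable fun x => p x a)
    -- the random triple `(x, a, r)` on a probability space `(Ω, P)`
    {Ω : Type*} [MeasurableSpace Ω] (P : Measure Ω) [IsProbabilityMeasure P]
    (ξ : Ω → X) (α : Ω → Fin 2) (ρ : Ω → Fin 2 → ℝ)
    (hξ : Measurable ξ) (hα : Measurable α) (hρm : ∀ a, Measurable fun ω => ρ ω a)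
    (hρ : ∀ ω a, ρ ω a ∈ Set.Icc (0 : ℝ) 1)
    -- `f*(x,a) = E[r(a) | x]`
    (fstar : X → Fin 2 → ℝ)
    (hfm : ∀ a, Measurable fun x => fstar x a)
    (hfb : ∀ x a, fstar x a ∈ Set.Icc (0 : ℝ) 1)
    (hortho : ∀ ψ : X → Fin 2 → ℝ, (∀ a, Measurable fun x => ψ x a) →
      (∃ C, ∀ x a, |ψ x a| ≤ C) →
      ∫ ω, (ρ ω (α ω) - fstar (ξ ω) (α ω)) * ψ (ξ ω) (α ω) ∂P = 0)
    -- `x` has law `ν` and, conditionally on `x`, `a ∼ p(·|x)`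
    (hlaw : ∀ φ : X → Fin 2 → ℝ, (∀ a, Measurable fun x => φ x a) →
      (∃ C, ∀ x a, |φ x a| ≤ C) →
      ∫ ω, φ (ξ ω) (α ω) ∂P = ∫ x, ∑ a, p x a * φ x a ∂ν)
    -- the fixed nuisance estimate `μ̂`
    (μhat : X → ℝ) (hμm : Measurable μhat) (hμb : ∃ C, ∀ x, |μhat x| ≤ C) :
    ∀ g : X → Fin 2 → ℝ,
      (∀ a, Measurable fun x => g x a) → (∃ C, ∀ x a, |g x a| ≤ C) →
      Rloss P p ξ α ρ μhat g - Rloss P p ξ α ρ μhat fstar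
        = ∫ x, p x 1 * (1 - p x 1) *
            ((g x 1 - g x 0) - (fstar x 1 - fstar x 0)) ^ 2 ∂ν := by
  intro g hgm hgb
  have Bp : ∀ a, BM (fun x => p x a) := fun a => ⟨hpm a, 1, fun x => by
    rw [abs_of_nonneg (hp0 x a), ← hp1 x]
    exact Finset.single_le_sum (fun i _ => hp0 x i) (Finset.mem_univ a)⟩
  have Bf : ∀ a, BM (fun x => fstar x a) := fun a => ⟨hfm a, 1, fun x => by
    rw [abs_of_nonneg (hfb x a).1]
    exact (hfb x a).2⟩
  have Bg : ∀ a, BM (fun x => g x a) := fun a => ⟨hgm a, hgb.imp fun C h x => h x a⟩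
  have Br : ∀ a, BM (fun ω => ρ ω a) := fun a => ⟨hρm a, 1, fun x => by
    rw [abs_of_nonneg (hρ x a).1]
    exact (hρ x a).2⟩
  have Bμ : BM μhat := ⟨hμm, hμb⟩
  have BD : ∀ h : X → Fin 2 → ℝ, (∀ a, BM (fun x => h x a)) →
      ∀ a, BM (fun x => h x a - ∑ a', p x a' * h x a') := by
    intro h Bh a
    simp only [Fin.sum_univ_two]
    exact (Bh a).sub (((Bp 0).mul (Bh 0)).add ((Bp 1).mul (Bh 1)))
  have BL : ∀ h : X → Fin 2 → ℝ, (∀ a, BM (fun x => h x a)) →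
      BM (fun ω => (ρ ω (α ω) - μhat (ξ ω) -
      (h (ξ ω) (α ω) - ∑ a', p (ξ ω) a' * h (ξ ω) a')) ^ 2) := by
    intro h Bh
    have h1 := ((BM.pick Br hα).sub (Bμ.comp hξ)).sub
      (BM.pick (F := fun ω a => h (ξ ω) a - ∑ a', p (ξ ω) a' * h (ξ ω) a')
        (fun a => (BD h Bh a).comp hξ) hα)
    simpa only [pow_two] using h1.mul h1
  let ψ : X → Fin 2 → ℝ := fun x a =>
    2 * ((fstar x a - ∑ a', p x a' * fstar x a') - (g x a - ∑ a', p x a' * g x a'))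
  let φ : X → Fin 2 → ℝ := fun x a =>
    ((fstar x a - ∑ a', p x a' * fstar x a') - (g x a - ∑ a', p x a' * g x a')) *
    (2 * (fstar x a - μhat x) - ((fstar x a - ∑ a', p x a' * fstar x a')
      + (g x a - ∑ a', p x a' * g x a')))
  have Bψ : ∀ a, BM (fun x => ψ x a) := fun a =>
    (BM.const 2).mul ((BD _ Bf a).sub (BD _ Bg a))
  have Bφ : ∀ a, BM (fun x => φ x a) := fun a =>
    ((BD _ Bf a).sub (BD _ Bg a)).mul
      (((BM.const 2).mul ((Bf a).sub Bμ)).sub ((BD _ Bf a).add (BD _ Bg a)))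
  have Bfα : BM (fun ω => fstar (ξ ω) (α ω)) :=
    BM.pick (F := fun ω a => fstar (ξ ω) a) (fun a => (Bf a).comp hξ) hα
  have Bψα : BM (fun ω => ψ (ξ ω) (α ω)) :=
    BM.pick (F := fun ω a => ψ (ξ ω) a) (fun a => (Bψ a).comp hξ) hα
  have Bφα : BM (fun ω => φ (ξ ω) (α ω)) :=
    BM.pick (F := fun ω a => φ (ξ ω) a) (fun a => (Bφ a).comp hξ) hα
  have h1 := hortho ψ (fun a => (Bψ a).1) (BM.bdd Bψ)
  have h2 := hlaw φ (fun a => (Bφ a).1) (BM.bdd Bφ)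
  have h3 := integral_add ((((BM.pick Br hα).sub Bfα).mul Bψα).int P) (Bφα.int P)
  rw [h1, h2, zero_add] at h3
  unfold Rloss
  rw [← integral_sub ((BL g Bg).int P) ((BL fstar Bf).int P)]
  have e1 : ∀ x, p x 0 = 1 - p x 1 := fun x => by
    have := hp1 x
    rw [Fin.sum_univ_two] at this
    linarith
  refine (Eq.trans ?_ h3).trans ?_
  · congr 1
    funext ω
    simp only [ψ, φ]
    ring
  · congr 1
    funext x
    simp only [φ, Fin.sum_univ_two, e1]
    ring
end

section
/- For the inverse-gap-weighting kernel p built from ĝ, â, and γ, the expected estimated regret of the induced randomized policy is at most K/γ: E_{x∼ν}[Σ_{a∈A} p(a|x) (ĝ(x,â(x)) − ĝ(x,a))] ≤ K/γ. -/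
theorem igw_expected_estimated_regret_le
    {X : Type*} [MeasurableSpace X] (ν : MeasureTheory.Measure X)
    [MeasureTheory.IsProbabilityMeasure ν]
    {A : Type*} [Fintype A] [Nonempty A] [DecidableEq A]
    -- the estimated model, valued in [0,1]
    (ghat : X → A → ℝ) (hgb : ∀ x a, ghat x a ∈ Set.Icc (0 : ℝ) 1)
    (hgm : ∀ a, Measurable fun x => ghat x a)
    -- a selection of the predicted best action
    (ahat : X → A) (hmax : ∀ x a, ghat x a ≤ ghat x (ahat x))
    (γ : ℝ) (hγ : 0 < γ)
    -- the inverse-gap-weighting kernel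
    (p : X → A → ℝ)
    (hp : ∀ x a, a ≠ ahat x →
      p x a = 1 / (Fintype.card A + γ * (ghat x (ahat x) - ghat x a)))
    (hpa : ∀ x, p x (ahat x) = 1 - ∑ a ∈ Finset.univ.erase (ahat x), p x a)
    [MeasurableSpace A] [MeasurableSingletonClass A] (hahat : Measurable ahat) :
    ∫ x, ∑ a, p x a * (ghat x (ahat x) - ghat x a) ∂ν ≤ Fintype.card A / γ := by
  have hK : (0 : ℝ) < Fintype.card A := by exact_mod_cast Fintype.card_pos
  have key : ∀ x a, 0 ≤ p x a * (ghat x (ahat x) - ghat x a) ∧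
      p x a * (ghat x (ahat x) - ghat x a) ≤ 1 / γ := by
    intro x a
    by_cases h : a = ahat x
    · subst h
      simp only [sub_self, mul_zero, le_refl, true_and]
      positivity
    · have hg : 0 ≤ ghat x (ahat x) - ghat x a := sub_nonneg.2 (hmax x a)
      rw [hp x a h]
      generalize ghat x (ahat x) - ghat x a = d at hg
      have hd : 0 < (Fintype.card A : ℝ) + γ * d := by positivity
      refine ⟨by positivity, ?_⟩
      rw [one_div_mul_eq_div, div_le_div_iff₀ hd hγ]
      nlinarith
  have hpt : ∀ x, ∑ a, p x a * (ghat x (ahat x) - ghat x a) ≤ Fintype.card A / γ := by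
    intro x
    calc _ ≤ ∑ _a : A, 1 / γ := Finset.sum_le_sum fun a _ => (key x a).2
      _ = _ := by simp [div_eq_mul_inv]
  calc _ ≤ ∫ _x, (Fintype.card A / γ : ℝ) ∂ν :=
        MeasureTheory.integral_mono_of_nonneg
          (Filter.Eventually.of_forall fun x => Finset.sum_nonneg fun a _ => (key x a).1)
          (MeasureTheory.integrable_const _) (Filter.Eventually.of_forall hpt)
    _ = _ := by simp
end

section
/- For the inverse-gap-weighting kernel p built from ĝ, â, and γ, and any measurable policy π : X → A, the expected inverse probability of π under p is bounded by K plus γ times the expected estimated regret of π: E_{x∼ν}[1/p(π(x)|x)] ≤ K + γ · E_{x∼ν}[ĝ(x,â(x)) − ĝ(x,π(x))]. -/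
theorem igw_expected_inverse_probability_bound
    {X : Type*} [MeasurableSpace X] (ν : MeasureTheory.Measure X)
    [MeasureTheory.IsProbabilityMeasure ν]
    {A : Type*} [Fintype A] [Nonempty A] [DecidableEq A]
    -- the estimated model, valued in [0,1]
    (ghat : X → A → ℝ) (hgb : ∀ x a, ghat x a ∈ Set.Icc (0 : ℝ) 1)
    (hgm : ∀ a, Measurable fun x => ghat x a)
    -- a selection of the predicted best action
    (ahat : X → A) (hmax : ∀ x a, ghat x a ≤ ghat x (ahat x))
    (γ : ℝ) (hγ : 0 < γ)
    -- the inverse-gap-weighting kernel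
    (p : X → A → ℝ)
    (hp : ∀ x a, a ≠ ahat x →
      p x a = 1 / (Fintype.card A + γ * (ghat x (ahat x) - ghat x a)))
    (hpa : ∀ x, p x (ahat x) = 1 - ∑ a ∈ Finset.univ.erase (ahat x), p x a)
    [MeasurableSpace A] [MeasurableSingletonClass A] (hahat : Measurable ahat)
    -- a measurable policy
    (π : X → A) (hπ : Measurable π) :
    ∫ x, 1 / p x (π x) ∂ν
      ≤ Fintype.card A + γ * ∫ x, (ghat x (ahat x) - ghat x (π x)) ∂ν := by
  have hm : ∀ f : X → A, Measurable f → Measurable fun x => ghat x (f x) := by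
    intro f hf
    have h : Measurable (fun q : X × A => ghat q.1 q.2) :=
      measurable_from_prod_countable_left (fun a => hgm a)
    exact h.comp (measurable_id.prodMk hf)
  have hint : ∀ f : X → A, Measurable f → MeasureTheory.Integrable (fun x => ghat x (f x)) ν := by
    intro f hf
    refine MeasureTheory.Integrable.of_bound (hm f hf).aestronglyMeasurable 1 ?_
    refine Filter.Eventually.of_forall fun x => ?_
    rw [Real.norm_eq_abs, abs_le]
    have := hgb x (f x)
    exact ⟨by linarith [this.1], this.2⟩
  have hi := ((hint ahat hahat).sub (hint π hπ)).const_mul γ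
  have hK : (0 : ℝ) < Fintype.card A := by exact_mod_cast Fintype.card_pos
  have hd : ∀ x a, (Fintype.card A : ℝ) ≤ Fintype.card A + γ * (ghat x (ahat x) - ghat x a) := by
    intro x a
    have := mul_nonneg hγ.le (sub_nonneg.2 (hmax x a))
    linarith
  have hbest : ∀ x, 1 / (Fintype.card A : ℝ) ≤ p x (ahat x) := by
    intro x
    have h1 : ∑ a ∈ Finset.univ.erase (ahat x), p x a
        ≤ ∑ a ∈ Finset.univ.erase (ahat x), 1 / (Fintype.card A : ℝ) := by
      refine Finset.sum_le_sum fun a ha => ?_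
      rw [hp x a (Finset.ne_of_mem_erase ha)]
      exact one_div_le_one_div_of_le hK (hd x a)
    have h2 := Finset.add_sum_erase Finset.univ (fun _ : A => 1 / (Fintype.card A : ℝ))
      (Finset.mem_univ (ahat x))
    have h3 : ∑ _a : A, 1 / (Fintype.card A : ℝ) = 1 := by
      simp [hK.ne']
    rw [hpa x]
    linarith
  have key : ∀ x, 0 ≤ 1 / p x (π x) ∧
      1 / p x (π x) ≤ Fintype.card A + γ * (ghat x (ahat x) - ghat x (π x)) := by
    intro x
    by_cases h : π x = ahat x
    · rw [h]
      have h1 := hbest x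
      have h0 : 0 < 1 / (Fintype.card A : ℝ) := by positivity
      refine ⟨(one_div_pos.2 (h0.trans_le h1)).le, ?_⟩
      have := one_div_le_one_div_of_le h0 h1
      rw [one_div_one_div] at this
      linarith [hd x (ahat x)]
    · rw [hp x _ h, one_div_one_div]
      exact ⟨hK.le.trans (hd x _), le_rfl⟩
  calc ∫ x, 1 / p x (π x) ∂ν
      ≤ ∫ x, ((Fintype.card A : ℝ) + γ * (ghat x (ahat x) - ghat x (π x))) ∂ν :=
        MeasureTheory.integral_mono_of_nonneg (Filter.Eventually.of_forall fun x => (key x).1)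
          ((MeasureTheory.integrable_const _).add hi)
          (Filter.Eventually.of_forall fun x => (key x).2)
    _ = _ := by
        have e := MeasureTheory.integral_add
          (MeasureTheory.integrable_const (μ := ν) (Fintype.card A : ℝ)) hi
        simp only [Pi.sub_apply] at e
        rw [e, MeasureTheory.integral_const_mul]
        simp
end

section
/- Let p be a probability kernel with p(a|x) > 0 for all x ∈ X, a ∈ A, let π : X → A be a measurable policy with E_{x∼ν}[1/p(π(x)|x)] < ∞, and let g, g* : X×A → ℝ be bounded measurable. Then |E_{x∼ν}[⟨e_{π(x)} − p(x), g(x,·) − g*(x,·)⟩]| ≤ √(E_{x∼ν}[1/p(π(x)|x)]) · √(E_{x∼ν}[Σ_{a∈A} p(a|x) ⟨e_a − p(x), g(x,·) − g*(x,·)⟩²]). -/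
theorem centered_difference_cauchy_schwarz
    {X : Type*} [MeasurableSpace X] (ν : MeasureTheory.Measure X)
    [MeasureTheory.IsProbabilityMeasure ν]
    {A : Type*} [Fintype A] [Nonempty A]
    [MeasurableSpace A] [MeasurableSingletonClass A]
    -- a probability kernel with strictly positive probabilities
    (p : X → A → ℝ)
    (hp0 : ∀ x a, 0 < p x a) (hp1 : ∀ x, ∑ a, p x a = 1)
    (hpm : ∀ a, Measurable fun x => p x a)
    -- a measurable policy with integrable inverse probabilities
    (π : X → A) (hπ : Measurable π)
    (hint : MeasureTheory.Integrable (fun x => 1 / p x (π x)) ν)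
    -- bounded measurable functions `g`, `g*`
    (g gstar : X → A → ℝ)
    (hgm : ∀ a, Measurable fun x => g x a) (hgb : ∃ C, ∀ x a, |g x a| ≤ C)
    (hgsm : ∀ a, Measurable fun x => gstar x a) (hgsb : ∃ C, ∀ x a, |gstar x a| ≤ C) :
    |∫ x, ((g x (π x) - gstar x (π x))
        - ∑ a', p x a' * (g x a' - gstar x a')) ∂ν|
      ≤ Real.sqrt (∫ x, 1 / p x (π x) ∂ν)
        * Real.sqrt (∫ x, ∑ a, p x a *
            ((g x a - gstar x a) - ∑ a', p x a' * (g x a' - gstar x a')) ^ 2 ∂ν) := by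
  classical
  obtain ⟨C1, hC1⟩ := hgb
  obtain ⟨C2, hC2⟩ := hgsb
  set d : X → A → ℝ := fun x a => (g x a - gstar x a) - ∑ a', p x a' * (g x a' - gstar x a')
    with hd
  have hf : ∀ x a, |g x a - gstar x a| ≤ C1 + C2 := fun x a =>
    (abs_sub _ _).trans (add_le_add (hC1 x a) (hC2 x a))
  have hdm : ∀ a, Measurable fun x => d x a := by
    intro a
    refine ((hgm a).sub (hgsm a)).sub ?_
    exact Finset.measurable_sum _ fun a' _ => (hpm a').mul ((hgm a').sub (hgsm a'))
  have hdb : ∀ x a, |d x a| ≤ (C1 + C2) + (C1 + C2) := by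
    intro x a
    refine (abs_sub _ _).trans (add_le_add (hf x a) ?_)
    calc |∑ a', p x a' * (g x a' - gstar x a')|
        ≤ ∑ a', |p x a' * (g x a' - gstar x a')| := Finset.abs_sum_le_sum_abs _ _
      _ ≤ ∑ a', p x a' * (C1 + C2) := by
          refine Finset.sum_le_sum fun a' _ => ?_
          rw [abs_mul, abs_of_pos (hp0 x a')]
          exact mul_le_mul_of_nonneg_left (hf x a') (hp0 x a').le
      _ = C1 + C2 := by rw [← Finset.sum_mul, hp1, one_mul]
  have hhm : Measurable fun x => d x (π x) := by
    have : (fun x => d x (π x)) = fun x => ∑ a, if π x = a then d x a else 0 := by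
      funext x; simp
    rw [this]
    exact Finset.measurable_sum _ fun a _ =>
      Measurable.ite (hπ (measurableSet_singleton a)) (hdm a) measurable_const
  have hvm : Measurable fun x => ∑ a, p x a * (d x a) ^ 2 :=
    Finset.measurable_sum _ fun a _ => (hpm a).mul ((hdm a).pow_const 2)
  have hv0 : ∀ x, 0 ≤ ∑ a, p x a * (d x a) ^ 2 := fun x =>
    Finset.sum_nonneg fun a _ => mul_nonneg (hp0 x a).le (sq_nonneg _)
  have hhi : MeasureTheory.Integrable (fun x => d x (π x)) ν :=
    MeasureTheory.Integrable.of_bound hhm.aestronglyMeasurable _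
      (Filter.Eventually.of_forall fun x => hdb x (π x))
  have hvi : MeasureTheory.Integrable (fun x => ∑ a, p x a * (d x a) ^ 2) ν := by
    refine MeasureTheory.Integrable.of_bound hvm.aestronglyMeasurable
      (((C1 + C2) + (C1 + C2)) ^ 2) (Filter.Eventually.of_forall fun x => ?_)
    rw [Real.norm_eq_abs, abs_of_nonneg (hv0 x)]
    calc ∑ a, p x a * (d x a) ^ 2 ≤ ∑ a, p x a * ((C1 + C2) + (C1 + C2)) ^ 2 := by
          refine Finset.sum_le_sum fun a _ => mul_le_mul_of_nonneg_left ?_ (hp0 x a).le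
          rw [← sq_abs]
          exact pow_le_pow_left₀ (abs_nonneg _) (hdb x a) 2
      _ = _ := by rw [← Finset.sum_mul, hp1, one_mul]
  change |∫ x, d x (π x) ∂ν| ≤ Real.sqrt (∫ x, 1 / p x (π x) ∂ν)
    * Real.sqrt (∫ x, ∑ a, p x a * (d x a) ^ 2 ∂ν)
  have key : ∀ t : ℝ, 0 ≤ (∫ x, 1 / p x (π x) ∂ν) * (t * t) + (2 * ∫ x, d x (π x) ∂ν) * t
      + ∫ x, ∑ a, p x a * (d x a) ^ 2 ∂ν := by
    intro t
    have e : (∫ x, 1 / p x (π x) ∂ν) * (t * t) + (2 * ∫ x, d x (π x) ∂ν) * t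
      + ∫ x, ∑ a, p x a * (d x a) ^ 2 ∂ν
      = ∫ x, ((1 / p x (π x)) * (t * t) + d x (π x) * (2 * t))
          + ∑ a, p x a * (d x a) ^ 2 ∂ν := by
      have hi : MeasureTheory.Integrable
          (fun x => (1 / p x (π x)) * (t * t) + d x (π x) * (2 * t)) ν :=
        (hint.mul_const _).add (hhi.mul_const _)
      rw [MeasureTheory.integral_add hi hvi,
        MeasureTheory.integral_add (hint.mul_const _) (hhi.mul_const _),
        MeasureTheory.integral_mul_const, MeasureTheory.integral_mul_const]
      ring
    rw [e]
    refine MeasureTheory.integral_nonneg fun x => ?_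
    have h1 : p x (π x) * (d x (π x)) ^ 2 ≤ ∑ a, p x a * (d x a) ^ 2 :=
      Finset.single_le_sum (f := fun a => p x a * (d x a) ^ 2)
        (fun a _ => mul_nonneg (hp0 x a).le (sq_nonneg _)) (Finset.mem_univ (π x))
    have hp := hp0 x (π x)
    have h2 : (1 / p x (π x)) * (t * t) + d x (π x) * (2 * t) + p x (π x) * (d x (π x)) ^ 2
        = (t + p x (π x) * d x (π x)) ^ 2 / p x (π x) := by
      field_simp
      ring
    have h3 : 0 ≤ (t + p x (π x) * d x (π x)) ^ 2 / p x (π x) := by positivity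
    show 0 ≤ (1 / p x (π x)) * (t * t) + d x (π x) * (2 * t) + ∑ a, p x a * (d x a) ^ 2
    linarith
  have hdisc := discrim_le_zero key
  rw [discrim] at hdisc
  have hU : 0 ≤ ∫ x, 1 / p x (π x) ∂ν :=
    MeasureTheory.integral_nonneg fun x => (one_div_pos.mpr (hp0 x (π x))).le
  rw [← Real.sqrt_mul hU]
  apply Real.abs_le_sqrt
  linarith
end

section
/- Let X be a finite set with a probability distribution ν, let ĝ : X×A → [0,1], let â(x) ∈ argmax_{a∈A} ĝ(x,a), let γ > 0, and let p be the inverse-gap-weighting kernel built from ĝ, â, γ. Let f* : X×A → ℝ, fix a policy π*, and for each policy π define Reg(π) := Σ_{x∈X} ν(x)(f*(x,π*(x)) − f*(x,π(x))) and Reg_ĝ(π) := Σ_{x∈X} ν(x)(ĝ(x,â(x)) − ĝ(x,π(x))). Suppose there is a constant c ≥ 0 such that Reg(π) ≤ 2·Reg_ĝ(π) + cK/γ for every policy π ∈ A^X. Then Σ_{π ∈ A^X} Q_p(π) Reg(π) ≤ (2 + c)K/γ. -/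
theorem igw_marg {X A : Type*} [Fintype X] [Fintype A] [DecidableEq X]
    (p : X → A → ℝ) (h1 : ∀ x, ∑ a, p x a = 1) (x : X) (h : A → ℝ) :
    ∑ π : X → A, (∏ x', p x' (π x')) * h (π x) = ∑ a, p x a * h a := by
  have key := Finset.prod_univ_sum (fun _ : X => (Finset.univ : Finset A))
    (fun x' a => p x' a * (if x' = x then h a else 1))
  rw [Fintype.piFinset_univ] at key
  have e1 : ∀ π : X → A, ∏ x', (p x' (π x') * (if x' = x then h (π x') else 1))
      = (∏ x', p x' (π x')) * h (π x) := by
    intro π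
    rw [Finset.prod_mul_distrib, Finset.prod_ite_eq' Finset.univ x (fun y => h (π y))]
    simp
  simp only [e1] at key
  rw [← key, Finset.prod_eq_single x]
  · simp
  · intro b _ hb
    simp [hb, h1]
  · simp

theorem igw_implicit_true_regret_bound
    {X A : Type*} [Fintype X] [Fintype A] [Nonempty A] [DecidableEq X] [DecidableEq A]
    -- a probability distribution on the finite context set `X`
    (ν : X → ℝ) (hν0 : ∀ x, 0 ≤ ν x) (hν1 : ∑ x, ν x = 1)
    -- the estimated model, valued in [0,1]
    (ghat : X → A → ℝ) (hgb : ∀ x a, ghat x a ∈ Set.Icc (0 : ℝ) 1)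
    -- a selection of the predicted best action
    (ahat : X → A) (hmax : ∀ x a, ghat x a ≤ ghat x (ahat x))
    (γ : ℝ) (hγ : 0 < γ)
    -- the inverse-gap-weighting kernel
    (p : X → A → ℝ)
    (hp : ∀ x a, a ≠ ahat x →
      p x a = 1 / (Fintype.card A + γ * (ghat x (ahat x) - ghat x a)))
    (hpa : ∀ x, p x (ahat x) = 1 - ∑ a ∈ Finset.univ.erase (ahat x), p x a)
    -- true rewards, the comparator policy, and the regret comparison hypothesis
    (fstar : X → A → ℝ) (πstar : X → A)
    (c : ℝ) (hc0 : 0 ≤ c)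
    (hc : ∀ π : X → A,
      (∑ x, ν x * (fstar x (πstar x) - fstar x (π x)))
        ≤ 2 * (∑ x, ν x * (ghat x (ahat x) - ghat x (π x)))
          + c * Fintype.card A / γ) :
    ∑ π : X → A, (∏ x', p x' (π x'))
        * ∑ x, ν x * (fstar x (πstar x) - fstar x (π x))
      ≤ (2 + c) * Fintype.card A / γ := by
  have h1 : ∀ x, ∑ a, p x a = 1 := by
    intro x
    rw [← Finset.add_sum_erase _ _ (Finset.mem_univ (ahat x)), hpa x]
    ring
  have hK : (1 : ℝ) ≤ Fintype.card A := by
    exact_mod_cast Fintype.card_pos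
  have hpp : ∀ x a, a ≠ ahat x → 0 ≤ p x a ∧ p x a ≤ 1 / (Fintype.card A : ℝ) := by
    intro x a ha
    have hg := mul_nonneg hγ.le (sub_nonneg.2 (hmax x a))
    rw [hp x a ha]
    exact ⟨by positivity, one_div_le_one_div_of_le (by linarith) (by linarith)⟩
  have hp0 : ∀ x a, 0 ≤ p x a := by
    intro x a
    by_cases ha : a = ahat x
    · subst ha
      rw [hpa x]
      have h2 : ∑ a ∈ Finset.univ.erase (ahat x), p x a ≤
          ∑ a ∈ Finset.univ.erase (ahat x), 1 / (Fintype.card A : ℝ) :=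
        Finset.sum_le_sum fun a ha => (hpp x a (Finset.ne_of_mem_erase ha)).2
      have h3 : ∑ a ∈ Finset.univ.erase (ahat x), 1 / (Fintype.card A : ℝ) ≤
          ∑ a : A, 1 / (Fintype.card A : ℝ) :=
        Finset.sum_le_sum_of_subset_of_nonneg (Finset.erase_subset _ _)
          (fun _ _ _ => by positivity)
      have h4 : ∑ a : A, 1 / (Fintype.card A : ℝ) = 1 := by
        rw [Finset.sum_const, Finset.card_univ, nsmul_eq_mul]
        field_simp
      linarith
    · exact (hpp x a ha).1
  have hgap : ∀ x a, p x a * (ghat x (ahat x) - ghat x a) ≤ 1 / γ := by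
    intro x a
    by_cases ha : a = ahat x
    · subst ha
      simp [hγ.le]
    · have hg := mul_nonneg hγ.le (sub_nonneg.2 (hmax x a))
      rw [hp x a ha, div_mul_eq_mul_div, div_le_div_iff₀ (by linarith) hγ]
      linarith
  have hQ1 : ∑ π : X → A, ∏ x', p x' (π x') = 1 := by
    have key := Finset.prod_univ_sum (fun _ : X => (Finset.univ : Finset A)) p
    rw [Fintype.piFinset_univ] at key
    rw [← key]
    simp [h1]
  have hR : ∑ π : X → A, (∏ x', p x' (π x'))
        * ∑ x, ν x * (ghat x (ahat x) - ghat x (π x)) ≤ Fintype.card A / γ := by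
    have : ∑ π : X → A, (∏ x', p x' (π x'))
        * ∑ x, ν x * (ghat x (ahat x) - ghat x (π x))
        = ∑ x, ν x * ∑ a, p x a * (ghat x (ahat x) - ghat x a) := by
      simp_rw [Finset.mul_sum]
      rw [Finset.sum_comm]
      refine Finset.sum_congr rfl fun x _ => ?_
      rw [← Finset.mul_sum, ← igw_marg p h1 x (fun a => ghat x (ahat x) - ghat x a),
        Finset.mul_sum]
      refine Finset.sum_congr rfl fun π _ => ?_
      ring
    rw [this]
    calc _ ≤ ∑ x, ν x * ((Fintype.card A : ℝ) / γ) := by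
          refine Finset.sum_le_sum fun x _ => mul_le_mul_of_nonneg_left ?_ (hν0 x)
          calc _ ≤ ∑ a : A, 1 / γ := Finset.sum_le_sum fun a _ => hgap x a
            _ = _ := by
              rw [Finset.sum_const, Finset.card_univ, nsmul_eq_mul]
              ring
      _ = _ := by rw [← Finset.sum_mul, hν1, one_mul]
  calc _ ≤ ∑ π : X → A, (∏ x', p x' (π x')) *
        (2 * (∑ x, ν x * (ghat x (ahat x) - ghat x (π x))) + c * Fintype.card A / γ) :=
        Finset.sum_le_sum fun π _ => mul_le_mul_of_nonneg_left (hc π)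
          (Finset.prod_nonneg fun x _ => hp0 x _)
    _ = 2 * (∑ π : X → A, (∏ x', p x' (π x'))
        * ∑ x, ν x * (ghat x (ahat x) - ghat x (π x))) + c * Fintype.card A / γ := by
        simp_rw [mul_add]
        rw [Finset.sum_add_distrib, ← Finset.sum_mul, hQ1, one_mul, Finset.mul_sum]
        congr 1
        refine Finset.sum_congr rfl fun π _ => ?_
        ring
    _ ≤ 2 * (Fintype.card A / γ) + c * Fintype.card A / γ := by linarith
    _ = _ := by ring
end

section
/- Let p̂ be another measurable assignment of a vector p̂(·|x) ∈ ℝ^A to each x ∈ X (an estimated propensity), and define the approximate R-loss risk R_{p,p̂}(g) := E[(r(a) − μ̂(x) − ⟨e_a − p̂(x), g(x,·)⟩)²], where ⟨e_a − p̂(x), g(x,·)⟩ := g(x,a) − Σ_{a'} p̂(a'|x) g(x,a'). Then for every bounded measurable g : X×A → ℝ, R_{p,p̂}(g) = R_p(g) + E_{x∼ν}[⟨p(x) − p̂(x), g(x,·)⟩² − 2(μ(x) − μ̂(x)) ⟨p(x) − p̂(x), g(x,·)⟩], where R_p(g) := E[(r(a) − μ̂(x) − ⟨e_a − p(x), g(x,·)⟩)²],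 μ(x) := Σ_{a∈A} p(a|x) f*(x,a), and ⟨p(x) − p̂(x), g(x,·)⟩ := Σ_{a∈A} (p(a|x) − p̂(a|x)) g(x,a). -/
open MeasureTheory

/-- Bounded functions, measurable in the first variable. -/
def BddMeas {Y A : Type*} [MeasurableSpace Y] (F : Y → A → ℝ) : Prop :=
  (∀ a, Measurable fun y => F y a) ∧ ∃ C, ∀ y a, |F y a| ≤ C

namespace BddMeas
variable {Y A : Type*} [MeasurableSpace Y] {F G : Y → A → ℝ}

theorem sub (hF : BddMeas F) (hG : BddMeas G) : BddMeas (fun y a => F y a - G y a) := by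
  obtain ⟨mF, C, hC⟩ := hF
  obtain ⟨mG, D, hD⟩ := hG
  exact ⟨fun a => (mF a).sub (mG a), C + D, fun y a =>
    (abs_sub _ _).trans (add_le_add (hC y a) (hD y a))⟩

theorem mul (hF : BddMeas F) (hG : BddMeas G) : BddMeas (fun y a => F y a * G y a) := by
  obtain ⟨mF, C, hC⟩ := hF
  obtain ⟨mG, D, hD⟩ := hG
  refine ⟨fun a => (mF a).mul (mG a), C * D, fun y a => ?_⟩
  rw [abs_mul]
  exact mul_le_mul (hC y a) (hD y a) (abs_nonneg _) ((abs_nonneg _).trans (hC y a))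

theorem sum [Fintype A] (hF : BddMeas F) :
    BddMeas (fun y (_ : A) => ∑ a, F y a) := by
  obtain ⟨mF, C, hC⟩ := hF
  refine ⟨fun _ => Finset.measurable_sum _ fun a _ => mF a, ∑ _a : A, C, fun y _ => ?_⟩
  exact (Finset.abs_sum_le_sum_abs _ _).trans (Finset.sum_le_sum fun a _ => hC y a)

theorem const (c : ℝ) : BddMeas (fun (_ : Y) (_ : A) => c) :=
  ⟨fun _ => measurable_const, |c|, fun _ _ => le_rfl⟩

theorem comp {Ω : Type*} [MeasurableSpace Ω] (hF : BddMeas F) {ξ : Ω → Y} (hξ : Measurable ξ) :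
    BddMeas (fun ω a => F (ξ ω) a) := by
  obtain ⟨mF, C, hC⟩ := hF
  exact ⟨fun a => (mF a).comp hξ, C, fun y a => hC _ a⟩

theorem integrable [Fintype A] [MeasurableSpace A] [MeasurableSingletonClass A]
    (hF : BddMeas F) (P : Measure Y) [IsProbabilityMeasure P] {α : Y → A} (hα : Measurable α) :
    Integrable (fun y => F y (α y)) P := by
  obtain ⟨mF, C, hC⟩ := hF
  have h1 : Measurable (fun q : Y × A => F q.1 q.2) := measurable_from_prod_countable_left mF
  have h2 : Measurable (fun y => F y (α y)) := h1.comp (measurable_id.prodMk hα)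
  exact Integrable.of_bound h2.aestronglyMeasurable C
    (Filter.Eventually.of_forall fun y => by simpa using hC y (α y))

end BddMeas

theorem approximate_rloss_decomposition
    {X : Type*} [MeasurableSpace X] (ν : Measure X) [IsProbabilityMeasure ν]
    {A : Type*} [Fintype A] [Nonempty A]
    [MeasurableSpace A] [MeasurableSingletonClass A]
    -- the probability kernel `p`
    (p : X → A → ℝ)
    (hp0 : ∀ x a, 0 ≤ p x a) (hp1 : ∀ x, ∑ a, p x a = 1)
    (hpm : ∀ a, Measurable fun x => p x a)
    -- the random triple `(x, a, r)` on a probability space `(Ω, P)`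
    {Ω : Type*} [MeasurableSpace Ω] (P : Measure Ω) [IsProbabilityMeasure P]
    (ξ : Ω → X) (α : Ω → A) (ρ : Ω → A → ℝ)
    (hξ : Measurable ξ) (hα : Measurable α) (hρm : ∀ a, Measurable fun ω => ρ ω a)
    (hρ : ∀ ω a, ρ ω a ∈ Set.Icc (0 : ℝ) 1)
    -- `f*(x,a) = E[r(a) | x]`
    (fstar : X → A → ℝ)
    (hfm : ∀ a, Measurable fun x => fstar x a)
    (hfb : ∀ x a, fstar x a ∈ Set.Icc (0 : ℝ) 1)
    (hortho : ∀ ψ : X → A → ℝ, (∀ a, Measurable fun x => ψ x a) →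
      (∃ C, ∀ x a, |ψ x a| ≤ C) →
      ∫ ω, (ρ ω (α ω) - fstar (ξ ω) (α ω)) * ψ (ξ ω) (α ω) ∂P = 0)
    -- `x` has law `ν` and, conditionally on `x`, `a ∼ p(·|x)`
    (hlaw : ∀ φ : X → A → ℝ, (∀ a, Measurable fun x => φ x a) →
      (∃ C, ∀ x a, |φ x a| ≤ C) →
      ∫ ω, φ (ξ ω) (α ω) ∂P = ∫ x, ∑ a, p x a * φ x a ∂ν)
    -- the fixed nuisance estimate `μ̂`
    (μhat : X → ℝ) (hμm : Measurable μhat) (hμb : ∃ C, ∀ x, |μhat x| ≤ C)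
    -- the estimated propensity kernel
    (phat : X → A → ℝ)
    (hphm : ∀ a, Measurable fun x => phat x a) (hphb : ∃ C, ∀ x a, |phat x a| ≤ C) :
    ∀ g : X → A → ℝ, (∀ a, Measurable fun x => g x a) → (∃ C, ∀ x a, |g x a| ≤ C) →
      Rloss P phat ξ α ρ μhat g
        = Rloss P p ξ α ρ μhat g
          + ∫ x, ((∑ a, (p x a - phat x a) * g x a) ^ 2
              - 2 * ((∑ a, p x a * fstar x a) - μhat x)
                  * ∑ a, (p x a - phat x a) * g x a) ∂ν := by
  intro g hgm hgb
  have Bg : BddMeas g := ⟨hgm, hgb⟩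
  have Bph : BddMeas phat := ⟨hphm, hphb⟩
  have Bp : BddMeas p := ⟨hpm, 1, fun x a => by
    rw [abs_of_nonneg (hp0 x a), ← hp1 x]
    exact Finset.single_le_sum (fun b _ => hp0 x b) (Finset.mem_univ a)⟩
  have Bf : BddMeas fstar := ⟨hfm, 1, fun x a => by
    rw [abs_of_nonneg (hfb x a).1]; exact (hfb x a).2⟩
  have Bρ : BddMeas ρ := ⟨hρm, 1, fun x a => by
    rw [abs_of_nonneg (hρ x a).1]; exact (hρ x a).2⟩
  have Bμ : BddMeas (fun x (_ : A) => μhat x) :=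
    ⟨fun _ => hμm, hμb.imp fun C hC x _ => hC x⟩
  have BD := ((Bp.sub Bph).mul Bg).sum
  have Bh := Bg.sub (Bp.mul Bg).sum
  have Bφ := (BD.mul BD).sub (((BddMeas.const 2).mul ((Bf.sub Bμ).sub Bh)).mul BD)
  have B1 := (Bρ.sub (Bμ.comp hξ)).sub (Bh.comp hξ)
  have I1 := (B1.mul B1).integrable P hα
  have B2 := (BddMeas.const 2).mul BD
  have I2 := ((Bρ.sub (Bf.comp hξ)).mul (B2.comp hξ)).integrable P hα
  have I3 := (Bφ.comp hξ).integrable P hα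
  have h2 := hortho _ B2.1 B2.2
  have h3 := hlaw _ Bφ.1 Bφ.2
  have key : ∀ x, (∑ a, (p x a - phat x a) * g x a) ^ 2
              - 2 * ((∑ a, p x a * fstar x a) - μhat x)
                  * ∑ a, (p x a - phat x a) * g x a =
      ∑ a, p x a * ((∑ a, (p x a - phat x a) * g x a) * (∑ a, (p x a - phat x a) * g x a)
        - 2 * (fstar x a - μhat x - (g x a - ∑ a, p x a * g x a))
          * ∑ a, (p x a - phat x a) * g x a) := by
    intro x
    generalize (∑ a, (p x a - phat x a) * g x a) = D
    generalize hG : ∑ a, p x a * g x a = G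
    have : ∀ a, p x a * (D * D - 2 * (fstar x a - μhat x - (g x a - G)) * D)
      = p x a * (D * D + 2 * D * (μhat x - G)) - (p x a * fstar x a) * (2 * D)
        + (p x a * g x a) * (2 * D) := fun a => by ring
    simp only [this, Finset.sum_add_distrib, Finset.sum_sub_distrib, ← Finset.sum_mul, hp1, hG]
    ring
  simp_rw [key]
  rw [← h3]
  unfold Rloss
  rw [← sub_zero (∫ ω, (ρ ω (α ω) - μhat (ξ ω) -
      (g (ξ ω) (α ω) - ∑ a', p (ξ ω) a' * g (ξ ω) a')) ^ 2 ∂P), ← h2]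
  simp_rw [← pow_two] at I1
  rw [← integral_sub I1 I2]
  refine Eq.trans ?_ (integral_add (I1.sub I2) I3)
  congr 1
  ext ω
  simp only [Pi.sub_apply, sub_mul, Finset.sum_sub_distrib]
  ring
end
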